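/- arXiv:2410.11998 — 2 statements merged into one kernel-verified Lean document; each statement's English description precedes it below -/
import Mathlib

section
/- Lemma 6 (sum of a geometric term times a square root): For every real a with 0 < a < 1 and every Q ∈ ℕ, Σ_{q=0}^{Q−1} a^q √(q+1) ≤ (1/(1−a))·(1 + √π/(2√(−ln a))) ≤ 2/(1−a)^{3/2}. -/
open Finset

lemma sqrt_step_aux (n : ℕ) :
    Real.sqrt ((n : ℝ) + 1 + 1) - Real.sqrt ((n : ℝ) + 1)
      ≤ Real.sqrt ((n : ℝ) + 1) - Real.sqrt (n : ℝ) := by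
  have hn : (0 : ℝ) ≤ n := Nat.cast_nonneg n
  have h0 := Real.sq_sqrt hn
  have h1 := Real.sq_sqrt (show (0 : ℝ) ≤ n + 1 by linarith)
  have h2 := Real.sq_sqrt (show (0 : ℝ) ≤ n + 1 + 1 by linarith)
  have p0 := Real.sqrt_nonneg (n : ℝ)
  have p1 := Real.sqrt_nonneg ((n : ℝ) + 1)
  have p2 := Real.sqrt_nonneg ((n : ℝ) + 1 + 1)
  have : Real.sqrt ((n : ℝ) + 1 + 1) + Real.sqrt (n : ℝ) ≤ 2 * Real.sqrt ((n : ℝ) + 1) := by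
    refine le_of_abs_le (abs_le_of_sq_le_sq ?_ (by positivity))
    nlinarith [sq_nonneg (Real.sqrt ((n : ℝ) + 1 + 1) - Real.sqrt (n : ℝ))]
  linarith

lemma gauss_step_aux (l : ℝ) (hl : 0 < l) (n : ℕ) :
    Real.exp (-l * ((n : ℝ) + 1)) * (Real.sqrt ((n : ℝ) + 1) - Real.sqrt (n : ℝ))
      ≤ ∫ u in Real.sqrt (n : ℝ)..Real.sqrt ((n : ℝ) + 1), Real.exp (-l * u ^ 2) := by
  have hle : Real.sqrt (n : ℝ) ≤ Real.sqrt ((n : ℝ) + 1) := Real.sqrt_le_sqrt (by linarith)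
  have hc : Continuous (fun u : ℝ => Real.exp (-l * u ^ 2)) := by fun_prop
  have := intervalIntegral.integral_mono_on (μ := MeasureTheory.volume) hle
    (f := fun _ => Real.exp (-l * ((n : ℝ) + 1))) (g := fun u => Real.exp (-l * u ^ 2))
    (by simp) (hc.intervalIntegrable _ _) (by
      intro u hu
      apply Real.exp_le_exp.2
      have h1 := Real.sq_sqrt (show (0 : ℝ) ≤ n + 1 by positivity)
      have h2 : u ^ 2 ≤ n + 1 := by
        rw [← h1]
        exact pow_le_pow_left₀ ((Real.sqrt_nonneg _).trans hu.1) hu.2 2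
      nlinarith)
  rw [intervalIntegral.integral_const, smul_eq_mul, mul_comm] at this
  exact this

lemma partial_aux (l : ℝ) (hl : 0 < l) (n : ℕ) :
    (1 - Real.exp (-l)) * (∑ q ∈ Finset.range (n + 1), Real.exp (-l) ^ q * Real.sqrt (q + 1))
      + Real.exp (-l) ^ (n + 1) * Real.sqrt ((n : ℝ) + 1)
      ≤ 1 + ∫ u in (0 : ℝ)..Real.sqrt (n : ℝ), Real.exp (-l * u ^ 2) := by
  have hc : Continuous (fun u : ℝ => Real.exp (-l * u ^ 2)) := by fun_prop
  induction n with
  | zero => simp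
  | succ n ih =>
    rw [Finset.sum_range_succ]
    have h1 := gauss_step_aux l hl n
    have h2 := sqrt_step_aux n
    have h3 := intervalIntegral.integral_add_adjacent_intervals (μ := MeasureTheory.volume)
      (hc.intervalIntegrable 0 (Real.sqrt (n : ℝ)))
      (hc.intervalIntegrable (Real.sqrt (n : ℝ)) (Real.sqrt ((n : ℝ) + 1)))
    have h4 : Real.exp (-l * ((n : ℝ) + 1)) = Real.exp (-l) ^ (n + 1) := by
      rw [← Real.exp_nat_mul]; push_cast; ring_nf
    rw [h4] at h1
    have h5 := mul_le_mul_of_nonneg_left h2 (pow_nonneg (Real.exp_pos (-l)).le (n + 1))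
    push_cast
    rw [← h3, pow_succ _ (n + 1)]
    linarith

lemma first_aux (l : ℝ) (hl : 0 < l) (n : ℕ) :
    (1 - Real.exp (-l)) * (∑ q ∈ Finset.range n, Real.exp (-l) ^ q * Real.sqrt (q + 1))
      ≤ 1 + Real.sqrt (Real.pi / l) / 2 := by
  cases n with
  | zero => simp; positivity
  | succ n =>
    have h := partial_aux l hl n
    have h2 : 0 ≤ Real.exp (-l) ^ (n + 1) * Real.sqrt ((n : ℝ) + 1) := by positivity
    have h3 : (∫ u in (0 : ℝ)..Real.sqrt (n : ℝ), Real.exp (-l * u ^ 2))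
        ≤ Real.sqrt (Real.pi / l) / 2 := by
      rw [← integral_gaussian_Ioi, intervalIntegral.integral_of_le (Real.sqrt_nonneg _)]
      apply MeasureTheory.setIntegral_mono_set
      · exact (integrable_exp_neg_mul_sq hl).integrableOn
      · exact Filter.Eventually.of_forall fun x => (Real.exp_pos _).le
      · exact Set.Ioc_subset_Ioi_self.eventuallyLE
    linarith

/-- Lemma 6: sum of a geometric term times a square root. -/
theorem geometric_times_sqrt_sum_bound
    (a : ℝ) (ha0 : 0 < a) (ha1 : a < 1) (Q : ℕ) :
    (∑ q ∈ Finset.range Q, a ^ q * Real.sqrt (q + 1)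
        ≤ (1 / (1 - a)) * (1 + Real.sqrt Real.pi / (2 * Real.sqrt (-Real.log a))))
      ∧ (1 / (1 - a)) * (1 + Real.sqrt Real.pi / (2 * Real.sqrt (-Real.log a)))
          ≤ 2 / (1 - a) ^ ((3 : ℝ) / 2) := by
  have hl : 0 < -Real.log a := by linarith [Real.log_neg ha0 ha1]
  have h1a : 0 < 1 - a := by linarith
  constructor
  · have h := first_aux _ hl Q
    rw [neg_neg, Real.exp_log ha0, Real.sqrt_div Real.pi_pos.le, div_div,
      mul_comm (Real.sqrt (-Real.log a))] at h
    rw [one_div_mul_eq_div, le_div_iff₀ h1a, mul_comm]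
    exact h
  · have hpow : (1 - a) ^ ((3 : ℝ) / 2) = (1 - a) * Real.sqrt (1 - a) := by
      rw [Real.sqrt_eq_rpow, show (3 : ℝ) / 2 = 1 + 1 / 2 by norm_num, Real.rpow_add h1a,
        Real.rpow_one]
    have hs : 0 < Real.sqrt (1 - a) := Real.sqrt_pos.2 h1a
    have hs1 : Real.sqrt (1 - a) ≤ 1 := Real.sqrt_le_one.2 (by linarith)
    have hle : Real.sqrt (1 - a) ≤ Real.sqrt (-Real.log a) :=
      Real.sqrt_le_sqrt (by linarith [Real.log_le_sub_one_of_pos ha0])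
    have hpi : Real.sqrt Real.pi ≤ 2 := by
      rw [Real.sqrt_le_left (by norm_num)]
      linarith [Real.pi_le_four]
    have e1 : Real.sqrt Real.pi / (2 * Real.sqrt (-Real.log a)) ≤ 1 / Real.sqrt (1 - a) := by
      calc _ ≤ 2 / (2 * Real.sqrt (1 - a)) := by gcongr
        _ = _ := by field_simp
    have e2 : 1 ≤ 1 / Real.sqrt (1 - a) := by rwa [le_div_iff₀ hs, one_mul]
    rw [hpow]
    calc _ ≤ (1 / (1 - a)) * (1 / Real.sqrt (1 - a) + 1 / Real.sqrt (1 - a)) := by gcongr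
      _ = _ := by field_simp; norm_num
end

section
/- Deterministic coordinate-wise consensus bound without momentum: Let 0 < β₂ < 1, ε > 0, α > 0, R > 0. Let W ∈ ℝ^{N×N} be symmetric, entrywise nonnegative and doubly stochastic, with eigenvalues 1 = λ₁ > λ₂ ≥ … ≥ λ_N > −1, λ := max(|λ₂|,|λ_N|), and let J be the N×N all-ones matrix. For each i ∈ {1,…,N} and t ∈ {1,…,T} let g_i^{(t)} ∈ ℝ with |g_i^{(t)}| ≤ R, define v_i^{(0)} = 0, v_i^{(t)} = β₂ v_i^{(t−1)} + (g_i^{(t)})², α_t = α√((1−β₂^t)/(1−β₂)), and let e^{(t)} ∈ ℝ^N have entries e_i^{(t)} = −α_t g_i^{(t)}/√(ε + v_i^{(t)}). Let x^{(0)} ∈ ℝ^N have all entries equal and set x^{(t)} = W x^{(t−1)} + e^{(t)}, x̄^{(t)} = (1/N)J x^{(t)}. Then (1/T) · Σ_{t=1}^T ‖x^{(t−1)} − x̄^{(t−1)}‖₂² ≤ (2(1+λ²)α²N/((1−λ²)²(1−β₂))) · [ (1/T)·ln(1 + R²/(ε(1−β₂))) − ln(β₂) ]. -/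
open Finset Matrix Polynomial

/-- Spectral contraction on the mean-zero subspace. -/
theorem aux_contraction {N : ℕ} (hN : 1 < N) (W : Matrix (Fin N) (Fin N) ℝ)
    (hWsymm : W.IsSymm) (hWrow : ∀ i, ∑ j, W i j = 1)
    (eig : Fin N → ℝ)
    (heig : W.charpoly = ∏ i, (Polynomial.X - Polynomial.C (eig i)))
    (lam : ℝ) (hne : ∀ k : Fin N, k ≠ ⟨0, by omega⟩ → eig k ≠ 1)
    (hle : ∀ k : Fin N, eig k = 1 ∨ |eig k| ≤ lam)
    (y : Fin N → ℝ) (hy : ∑ i, y i = 0) :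
    ∑ i, (W.mulVec y i) ^ 2 ≤ lam ^ 2 * ∑ i, (y i) ^ 2 := by
  have hH : W.IsHermitian := by
    rw [Matrix.IsHermitian, Matrix.conjTranspose_eq_transpose_of_trivial]; exact hWsymm
  have hms : Multiset.map hH.eigenvalues Finset.univ.val = Multiset.map eig Finset.univ.val := by
    have h1 := hH.roots_charpoly_eq_eigenvalues
    have h2 : W.charpoly.roots = Multiset.map eig Finset.univ.val := by
      rw [heig, Polynomial.roots_prod]
      · simp
      · simp [Finset.prod_ne_zero_iff, Polynomial.X_sub_C_ne_zero]
    rw [h2] at h1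
    rw [h1]
    rfl
  have hle' : ∀ i, hH.eigenvalues i = 1 ∨ |hH.eigenvalues i| ≤ lam := by
    intro i
    have : hH.eigenvalues i ∈ Multiset.map eig Finset.univ.val := by
      rw [← hms]; exact Multiset.mem_map_of_mem _ (Finset.mem_univ i)
    obtain ⟨k, -, hk⟩ := Multiset.mem_map.1 this
    rw [← hk]; exact hle k
  have huniq : ∀ i j, hH.eigenvalues i = 1 → hH.eigenvalues j = 1 → i = j := by
    have hc := congrArg (Multiset.count (1 : ℝ)) hms
    rw [Multiset.count_map, Multiset.count_map] at hc
    have hr : (Finset.univ.filter (fun k => 1 = eig k)).card ≤ 1 := by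
      rw [Finset.card_le_one]
      intro a ha b hb
      simp only [Finset.mem_filter, Finset.mem_univ, true_and] at ha hb
      have h1 : a = ⟨0, by omega⟩ := by
        by_contra h; exact hne a h ha.symm
      have h2 : b = ⟨0, by omega⟩ := by
        by_contra h; exact hne b h hb.symm
      rw [h1, h2]
    have hl : (Finset.univ.filter (fun k => 1 = hH.eigenvalues k)).card ≤ 1 := by
      exact (le_of_eq hc).trans hr
    rw [Finset.card_le_one] at hl
    intro i j hi hj
    exact hl i (by simp [hi]) j (by simp [hj])
  obtain ⟨u, hu⟩ : ∃ u : Fin N → Fin N → ℝ, u = fun i => ⇑(hH.eigenvectorBasis i) := ⟨_, rfl⟩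
  have hpol : ∀ a b : Fin N → ℝ, ∑ i, (u i ⬝ᵥ a) * (u i ⬝ᵥ b) = a ⬝ᵥ b := by
    intro a b
    have := hH.eigenvectorBasis.sum_inner_mul_inner (WithLp.toLp 2 a) (WithLp.toLp 2 b)
    simp only [EuclideanSpace.inner_eq_star_dotProduct, star_trivial] at this
    rw [dotProduct_comm a b, ← this, hu]
    refine Finset.sum_congr rfl fun i _ => ?_
    rw [dotProduct_comm _ b]
  have heu : ∀ i, W *ᵥ u i = hH.eigenvalues i • u i := by
    intro i; rw [hu]; exact hH.mulVec_eigenvectorBasis i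
  have hWu : ∀ i a, u i ⬝ᵥ (W *ᵥ a) = hH.eigenvalues i * (u i ⬝ᵥ a) := by
    intro i a
    rw [Matrix.dotProduct_mulVec, ← Matrix.mulVec_transpose, hWsymm.eq, heu, smul_dotProduct,
      smul_eq_mul]
  have hW1 : W *ᵥ (1 : Fin N → ℝ) = 1 := by
    ext i; simp [Matrix.mulVec, dotProduct, hWrow]
  have h1z : ∀ i, hH.eigenvalues i ≠ 1 → u i ⬝ᵥ (1 : Fin N → ℝ) = 0 := by
    intro i hi
    have := hWu i 1
    rw [hW1] at this
    have h : (hH.eigenvalues i - 1) * (u i ⬝ᵥ (1 : Fin N → ℝ)) = 0 := by linarith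
    rcases mul_eq_zero.1 h with h | h
    · exact absurd (by linarith) hi
    · exact h
  have hyz : ∀ i, hH.eigenvalues i = 1 → u i ⬝ᵥ y = 0 := by
    intro i hi
    have hz : ∀ j, j ≠ i → u j ⬝ᵥ (1 : Fin N → ℝ) = 0 := fun j hj =>
      h1z j fun h => hj (huniq j i h hi)
    have e1 := hpol 1 y
    have e2 := hpol 1 1
    rw [Finset.sum_eq_single i (fun j _ hj => by rw [hz j hj, zero_mul]) (by simp)] at e1 e2
    have e3 : (1 : Fin N → ℝ) ⬝ᵥ y = 0 := by simpa [dotProduct] using hy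
    have e4 : (1 : Fin N → ℝ) ⬝ᵥ 1 = (N : ℝ) := by simp [dotProduct]
    rw [e3] at e1
    rw [e4] at e2
    rcases mul_eq_zero.1 e1 with h | h
    · rw [h] at e2
      have : (0 : ℝ) < N := by exact_mod_cast (by omega : 0 < N)
      linarith
    · exact h
  have s1 : ∑ i, (W.mulVec y i) ^ 2 = ∑ i, (u i ⬝ᵥ (W *ᵥ y)) ^ 2 := by
    simp only [pow_two, hpol]; rfl
  have s2 : ∑ i, (y i) ^ 2 = ∑ i, (u i ⬝ᵥ y) ^ 2 := by
    simp only [pow_two, hpol]; rfl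
  rw [s1, s2, Finset.mul_sum]
  refine Finset.sum_le_sum fun i _ => ?_
  rw [hWu]
  by_cases hi : hH.eigenvalues i = 1
  · rw [hyz i hi]; simp
  · have h := (hle' i).resolve_left hi
    rw [mul_pow]
    refine mul_le_mul_of_nonneg_right ?_ (sq_nonneg _)
    rw [← sq_abs]
    exact pow_le_pow_left₀ (abs_nonneg _) h 2

/-- Young-type inequality for the consensus recursion. -/
theorem aux_young {N : ℕ} (lam : ℝ) (h0 : 0 ≤ lam) (h1 : lam < 1) (a b : Fin N → ℝ) (Y : ℝ)
    (ha : ∑ i, (a i) ^ 2 ≤ lam ^ 2 * Y) (hY : 0 ≤ Y) :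
    ∑ i, (a i + b i) ^ 2
      ≤ (1 + lam ^ 2) / 2 * Y + (1 + lam ^ 2) / (1 - lam ^ 2) * ∑ i, (b i) ^ 2 := by
  have hl : 0 < 1 - lam ^ 2 := by nlinarith
  have hB : 0 ≤ ∑ i, (b i) ^ 2 := Finset.sum_nonneg fun i _ => sq_nonneg _
  rcases h0.eq_or_lt with h | h
  · subst h
    have hz : ∑ i, (a i) ^ 2 = 0 :=
      le_antisymm (by simpa using ha) (Finset.sum_nonneg fun i _ => sq_nonneg _)
    have hz' : ∀ i, a i = 0 := by
      intro i
      have := (Finset.sum_eq_zero_iff_of_nonneg (fun i _ => sq_nonneg (a i))).1 hz i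
        (Finset.mem_univ i)
      exact pow_eq_zero_iff (two_ne_zero) |>.1 this
    simp only [hz', zero_add]
    norm_num
    linarith
  · have key : ∀ i, (a i + b i) ^ 2 ≤ (1 + lam ^ 2) / (2 * lam ^ 2) * (a i) ^ 2
        + (1 + lam ^ 2) / (1 - lam ^ 2) * (b i) ^ 2 := by
      intro i
      have hid : (1 + lam ^ 2) / (2 * lam ^ 2) * (a i) ^ 2
        + (1 + lam ^ 2) / (1 - lam ^ 2) * (b i) ^ 2 - (a i + b i) ^ 2
        = ((1 - lam ^ 2) * a i - 2 * lam ^ 2 * b i) ^ 2 / (2 * lam ^ 2 * (1 - lam ^ 2)) := by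
        field_simp
        ring
      have : 0 ≤ ((1 - lam ^ 2) * a i - 2 * lam ^ 2 * b i) ^ 2 / (2 * lam ^ 2 * (1 - lam ^ 2)) := by
        positivity
      linarith
    calc ∑ i, (a i + b i) ^ 2 ≤ ∑ i, ((1 + lam ^ 2) / (2 * lam ^ 2) * (a i) ^ 2
        + (1 + lam ^ 2) / (1 - lam ^ 2) * (b i) ^ 2) := Finset.sum_le_sum fun i _ => key i
      _ = (1 + lam ^ 2) / (2 * lam ^ 2) * ∑ i, (a i) ^ 2
        + (1 + lam ^ 2) / (1 - lam ^ 2) * ∑ i, (b i) ^ 2 := by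
          rw [Finset.sum_add_distrib, Finset.mul_sum, Finset.mul_sum]
      _ ≤ (1 + lam ^ 2) / (2 * lam ^ 2) * (lam ^ 2 * Y)
        + (1 + lam ^ 2) / (1 - lam ^ 2) * ∑ i, (b i) ^ 2 := by gcongr
      _ = _ := by field_simp

/-- Centering does not increase the sum of squares. -/
theorem aux_center {N : ℕ} (hN : 0 < N) (b : Fin N → ℝ) :
    ∑ i, (b i - (N : ℝ)⁻¹ * ∑ j, b j) ^ 2 ≤ ∑ i, (b i) ^ 2 := by
  have hN' : (0 : ℝ) < N := by exact_mod_cast hN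
  have : ∑ i, (b i - (N : ℝ)⁻¹ * ∑ j, b j) ^ 2
      = ∑ i, (b i) ^ 2 - (N : ℝ)⁻¹ * (∑ j, b j) ^ 2 := by
    simp only [sub_sq, Finset.sum_add_distrib, Finset.sum_sub_distrib, Finset.sum_const,
      Finset.card_univ, Fintype.card_fin, nsmul_eq_mul, ← Finset.sum_mul, ← Finset.mul_sum]
    field_simp
    ring
  rw [this]
  have : 0 ≤ (N : ℝ)⁻¹ * (∑ j, b j) ^ 2 := by positivity
  linarith

/-- Summing the scalar recursion. -/
theorem aux_sum (q c : ℝ) (hq : 0 ≤ q) (Y E : ℕ → ℝ) (hY0 : Y 0 = 0) (hY : ∀ t, 0 ≤ Y t)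
    (hrec : ∀ t, Y (t + 1) ≤ q * Y t + c * E t) (T : ℕ) :
    (1 - q) * ∑ t ∈ Finset.range T, Y t ≤ c * ∑ t ∈ Finset.range T, E t := by
  have h : ∑ t ∈ Finset.range T, Y (t + 1) ≤ q * ∑ t ∈ Finset.range T, Y t
      + c * ∑ t ∈ Finset.range T, E t := by
    rw [Finset.mul_sum, Finset.mul_sum, ← Finset.sum_add_distrib]
    exact Finset.sum_le_sum fun t _ => hrec t
  have h2 := Finset.sum_range_succ' Y T
  have h3 := Finset.sum_range_succ Y T
  have := hY T
  linarith

/-- The logarithmic bound for the adaptive step sizes. -/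
theorem aux_log (β ε : ℝ) (hβ : 0 < β) (hβ1 : β < 1) (hε : 0 < ε) (g v : ℕ → ℝ)
    (hv0 : v 0 = 0) (hv : ∀ t, v (t + 1) = β * v t + (g (t + 1)) ^ 2) (T : ℕ) :
    0 ≤ v T ∧ ∑ t ∈ Finset.range T, (g (t + 1)) ^ 2 / (ε + v (t + 1))
      ≤ Real.log (ε + v T) - Real.log ε - T * Real.log β := by
  induction T with
  | zero => simp [hv0]
  | succ T ih =>
    obtain ⟨h0, ih⟩ := ih
    have h1 : 0 ≤ v (T + 1) := by rw [hv]; positivity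
    refine ⟨h1, ?_⟩
    rw [Finset.sum_range_succ]
    have hb : 0 < ε + v (T + 1) := by linarith
    have hc : 0 < β * (ε + v T) := by positivity
    have h2 := Real.one_sub_inv_le_log_of_pos (x := (ε + v (T + 1)) / (β * (ε + v T))) (by positivity)
    rw [Real.log_div hb.ne' hc.ne', Real.log_mul hβ.ne' (by linarith), inv_div] at h2
    have h3 : (g (T + 1)) ^ 2 / (ε + v (T + 1)) ≤ 1 - (β * (ε + v T)) / (ε + v (T + 1)) := by
      rw [le_sub_iff_add_le, ← add_div, div_le_one hb, hv T]
      nlinarith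
    push_cast
    linarith

theorem aux_vbound (β R : ℝ) (hβ : 0 < β) (hβ1 : β < 1) (g v : ℕ → ℝ) (T : ℕ)
    (hg : ∀ t, 1 ≤ t → t ≤ T → |g t| ≤ R)
    (hv0 : v 0 = 0) (hv : ∀ t, v (t + 1) = β * v t + (g (t + 1)) ^ 2) :
    ∀ t, t ≤ T → v t ≤ R ^ 2 / (1 - β) := by
  have hb : 0 < 1 - β := by linarith
  intro t
  induction t with
  | zero => intro _; rw [hv0]; positivity
  | succ t ih =>
    intro ht
    have h1 := ih (by omega)
    have h2 : (g (t + 1)) ^ 2 ≤ R ^ 2 := by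
      rw [← sq_abs]; exact pow_le_pow_left₀ (abs_nonneg _) (hg _ (by omega) ht) 2
    rw [hv]
    have h3 : β * v t ≤ β * (R ^ 2 / (1 - β)) := by gcongr
    have h4 : β * (R ^ 2 / (1 - β)) + R ^ 2 = R ^ 2 / (1 - β) := by field_simp; ring
    linarith

/-- Deterministic coordinate-wise consensus bound without momentum. -/
theorem deterministic_consensus_bound_no_momentum
    (N : ℕ) (hN : 1 < N)
    (T : ℕ) (hT : 1 ≤ T)
    (α β₂ ε R : ℝ)
    (hβ₂0 : 0 < β₂) (hβ₂1 : β₂ < 1) (hε : 0 < ε) (hα : 0 < α) (hR : 0 < R)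
    (W : Matrix (Fin N) (Fin N) ℝ)
    (hWsymm : W.IsSymm)
    (hWnonneg : ∀ i j, 0 ≤ W i j)
    (hWrow : ∀ i, ∑ j, W i j = 1)
    (hWcol : ∀ j, ∑ i, W i j = 1)
    (eig : Fin N → ℝ)
    (heig : W.charpoly = ∏ i, (Polynomial.X - Polynomial.C (eig i)))
    (hanti : Antitone eig)
    (heig1 : eig ⟨0, by omega⟩ = 1)
    (heig2 : eig ⟨1, hN⟩ < 1)
    (heiglast : -1 < eig ⟨N - 1, by omega⟩)
    (lam : ℝ) (hlam : lam = max |eig ⟨1, hN⟩| |eig ⟨N - 1, by omega⟩|)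
    (g : ℕ → Fin N → ℝ) (hg : ∀ t i, 1 ≤ t → t ≤ T → |g t i| ≤ R)
    (v : ℕ → Fin N → ℝ)
    (hv0 : ∀ i, v 0 i = 0)
    (hv : ∀ t i, v (t + 1) i = β₂ * v t i + (g (t + 1) i) ^ 2)
    (e : ℕ → Fin N → ℝ)
    (he : ∀ t i, e (t + 1) i
        = -(α * Real.sqrt ((1 - β₂ ^ (t + 1)) / (1 - β₂))) * g (t + 1) i
            / Real.sqrt (ε + v (t + 1) i))
    (x : ℕ → Fin N → ℝ)
    (hx0 : ∀ i j, x 0 i = x 0 j)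
    (hxrec : ∀ t : ℕ, x (t + 1) = W.mulVec (x t) + e (t + 1)) :
    (1 / (T : ℝ)) * ∑ t ∈ Finset.range T, ∑ i, (x t i - (N : ℝ)⁻¹ * ∑ j, x t j) ^ 2
      ≤ (2 * (1 + lam ^ 2) * α ^ 2 * N / ((1 - lam ^ 2) ^ 2 * (1 - β₂)))
          * ((1 / (T : ℝ)) * Real.log (1 + R ^ 2 / (ε * (1 - β₂))) - Real.log β₂) := by
  have hN0 : (0 : ℝ) < N := by exact_mod_cast (by omega : 0 < N)
  have hT0 : (0 : ℝ) < T := by exact_mod_cast (by omega : 0 < T)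
  have hb : 0 < 1 - β₂ := by linarith
  have hlast : eig ⟨N - 1, by omega⟩ ≤ eig ⟨1, hN⟩ := hanti (Fin.mk_le_mk.2 (by omega))
  have hlam0 : 0 ≤ lam := by rw [hlam]; exact le_max_of_le_left (abs_nonneg _)
  have hlam1 : lam < 1 := by
    rw [hlam]
    refine max_lt (abs_lt.2 ⟨by linarith, heig2⟩) (abs_lt.2 ⟨heiglast, by linarith⟩)
  have hk : ∀ k : Fin N, k ≠ ⟨0, by omega⟩ → eig k ≤ eig ⟨1, hN⟩ := by
    intro k hk
    refine hanti (Fin.mk_le_mk.2 ?_)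
    have : k.val ≠ 0 := fun h => hk (Fin.ext h)
    omega
  have hk2 : ∀ k : Fin N, eig ⟨N - 1, by omega⟩ ≤ eig k := by
    intro k
    exact hanti (Fin.mk_le_mk.2 (by omega))
  have hcontr := aux_contraction hN W hWsymm hWrow eig heig lam
    (fun k h => by have := hk k h; exact ne_of_lt (by linarith))
    (fun k => by
      by_cases h : k = ⟨0, by omega⟩
      · left; rw [h]; exact heig1
      · right
        rw [hlam]
        exact abs_le_max_abs_abs (hk2 k) (hk k h) |>.trans (le_of_eq (max_comm _ _)))
  have hl : 0 < 1 - lam ^ 2 := by nlinarith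
  -- the recursion
  have hmean : ∀ t, ∑ i, W.mulVec (x t) i = ∑ i, x t i := by
    intro t
    simp only [Matrix.mulVec, dotProduct]
    rw [Finset.sum_comm]
    refine Finset.sum_congr rfl fun j _ => ?_
    rw [← Finset.sum_mul, hWcol, one_mul]
  have hrec : ∀ t, ∑ i, (x (t + 1) i - (N : ℝ)⁻¹ * ∑ j, x (t + 1) j) ^ 2
      ≤ (1 + lam ^ 2) / 2 * (∑ i, (x t i - (N : ℝ)⁻¹ * ∑ j, x t j) ^ 2)
        + (1 + lam ^ 2) / (1 - lam ^ 2) * ∑ i, (e (t + 1) i) ^ 2 := by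
    intro t
    set m := (N : ℝ)⁻¹ * ∑ j, x t j with hm
    have hy0 : ∑ i, (x t i - m) = 0 := by
      rw [Finset.sum_sub_distrib]
      simp only [Finset.sum_const, Finset.card_univ, Fintype.card_fin, nsmul_eq_mul, hm]
      field_simp
      ring
    have hc := hcontr (fun i => x t i - m) hy0
    have hWy : ∀ i, W.mulVec (fun i => x t i - m) i = W.mulVec (x t) i - m := by
      intro i
      simp only [Matrix.mulVec, dotProduct, mul_sub, Finset.sum_sub_distrib]
      rw [← Finset.sum_mul, hWrow, one_mul]
    have hyo := aux_young lam hlam0 hlam1 (W.mulVec (fun i => x t i - m))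
      (fun i => e (t + 1) i - (N : ℝ)⁻¹ * ∑ j, e (t + 1) j) _ hc
      (Finset.sum_nonneg fun i _ => sq_nonneg _)
    have hce := aux_center (by omega) (e (t + 1))
    have heq : ∀ i, x (t + 1) i - (N : ℝ)⁻¹ * ∑ j, x (t + 1) j
        = W.mulVec (fun i => x t i - m) i + (e (t + 1) i - (N : ℝ)⁻¹ * ∑ j, e (t + 1) j) := by
      intro i
      rw [hWy, hxrec]
      simp only [Pi.add_apply, Finset.sum_add_distrib, hmean, hm]
      ring
    simp only [heq]
    refine hyo.trans ?_
    gcongr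
  have hS := aux_sum ((1 + lam ^ 2) / 2) ((1 + lam ^ 2) / (1 - lam ^ 2)) (by positivity)
    (fun t => ∑ i, (x t i - (N : ℝ)⁻¹ * ∑ j, x t j) ^ 2) (fun t => ∑ i, (e (t + 1) i) ^ 2)
    (by
      refine Finset.sum_eq_zero fun i _ => ?_
      have : ∑ j, x 0 j = N * x 0 i := by
        rw [Finset.sum_congr rfl fun j _ => hx0 j i]; simp
      rw [this]
      field_simp
      ring)
    (fun t => Finset.sum_nonneg fun i _ => sq_nonneg _) hrec T
  have hlog : ∀ i, ∑ t ∈ Finset.range T, (e (t + 1) i) ^ 2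
      ≤ α ^ 2 / (1 - β₂) * (Real.log (1 + R ^ 2 / (ε * (1 - β₂))) - T * Real.log β₂) := by
    intro i
    have hL := aux_log β₂ ε hβ₂0 hβ₂1 hε (fun t => g t i) (fun t => v t i) (hv0 i)
      (fun t => hv t i)
    have hV := aux_vbound β₂ R hβ₂0 hβ₂1 (fun t => g t i) (fun t => v t i) T
      (fun t => hg t i) (hv0 i) (fun t => hv t i) T le_rfl
    have h1 : ∀ t, (e (t + 1) i) ^ 2
        ≤ α ^ 2 / (1 - β₂) * ((g (t + 1) i) ^ 2 / (ε + v (t + 1) i)) := by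
      intro t
      have hv' : 0 ≤ v (t + 1) i := (hL (t + 1)).1
      have hp : β₂ ^ (t + 1) ≤ 1 := pow_le_one₀ hβ₂0.le hβ₂1.le
      have hp0 : 0 < β₂ ^ (t + 1) := by positivity
      rw [he, div_pow, Real.sq_sqrt (by linarith), mul_pow, neg_sq, mul_pow,
        Real.sq_sqrt (div_nonneg (by linarith) hb.le), mul_div_assoc]
      refine mul_le_mul_of_nonneg_right ?_ (by positivity)
      rw [div_eq_mul_one_div (α ^ 2)]
      gcongr
      linarith
    refine (Finset.sum_le_sum fun t _ => h1 t).trans ?_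
    rw [← Finset.mul_sum]
    refine mul_le_mul_of_nonneg_left ?_ (by positivity)
    refine (hL T).2.trans ?_
    have hv' := (hL T).1
    have : Real.log (ε + v T i) - Real.log ε ≤ Real.log (1 + R ^ 2 / (ε * (1 - β₂))) := by
      rw [← Real.log_div (by positivity) hε.ne']
      refine Real.log_le_log (by positivity) ?_
      rw [div_le_iff₀ hε]
      have : (1 + R ^ 2 / (ε * (1 - β₂))) * ε = ε + R ^ 2 / (1 - β₂) := by field_simp
      rw [this]
      linarith
    linarith
  have hE : ∑ t ∈ Finset.range T, ∑ i, (e (t + 1) i) ^ 2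
      ≤ N * (α ^ 2 / (1 - β₂) * (Real.log (1 + R ^ 2 / (ε * (1 - β₂))) - T * Real.log β₂)) := by
    rw [Finset.sum_comm]
    refine (Finset.sum_le_sum fun i _ => hlog i).trans ?_
    simp
  set L := Real.log (1 + R ^ 2 / (ε * (1 - β₂)))
  set B := Real.log β₂
  have hfin : (1 - (1 + lam ^ 2) / 2)
        * ∑ t ∈ Finset.range T, ∑ i, (x t i - (N : ℝ)⁻¹ * ∑ j, x t j) ^ 2
      ≤ (1 + lam ^ 2) / (1 - lam ^ 2) * (N * (α ^ 2 / (1 - β₂) * (L - T * B))) :=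
    hS.trans (mul_le_mul_of_nonneg_left hE (by positivity))
  set S := ∑ t ∈ Finset.range T, ∑ i, (x t i - (N : ℝ)⁻¹ * ∑ j, x t j) ^ 2
  have hS2 : S ≤ 2 / (1 - lam ^ 2)
      * ((1 + lam ^ 2) / (1 - lam ^ 2) * (N * (α ^ 2 / (1 - β₂) * (L - T * B)))) := by
    calc S = 2 / (1 - lam ^ 2) * ((1 - (1 + lam ^ 2) / 2) * S) := by field_simp; ring
      _ ≤ _ := mul_le_mul_of_nonneg_left hfin (by positivity)
  calc 1 / (T : ℝ) * S ≤ 1 / (T : ℝ) * _ := mul_le_mul_of_nonneg_left hS2 (by positivity)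
    _ = _ := by field_simp
end
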